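/- Let Γ be a finite simplicial graph and 𝒢 = (G_u) a family of nontrivial finite groups indexed by the vertices of Γ. Then the graph product Γ𝒢 is virtually free abelian (it contains a finite-index subgroup isomorphic to ℤⁿ for some n ≥ 0) if and only if every non-universal vertex u has G_u of order 2 and every vertex of Γ is non-adjacent to at most one other vertex of Γ. -/

import Mathlib

/-- The set of commutation relators defining a graph product. -/
def graphProdRels {V : Type*} (Γ : SimpleGraph V) (G : V → Type*) [∀ w, Group (G w)] :
    Set (Monoid.CoprodI G) :=
  {x | ∃ (u v : V) (_ : Γ.Adj u v) (g : G u) (h : G v),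
    x = Monoid.CoprodI.of g * Monoid.CoprodI.of h *
      (Monoid.CoprodI.of g)⁻¹ * (Monoid.CoprodI.of h)⁻¹}

/-- The graph product of the family of groups `G` over the simplicial graph `Γ`. -/
def GraphProduct {V : Type*} (Γ : SimpleGraph V) (G : V → Type*) [∀ w, Group (G w)] :=
  Monoid.CoprodI G ⧸ Subgroup.normalClosure (graphProdRels Γ G)

instance {V : Type*} (Γ : SimpleGraph V) (G : V → Type*) [∀ w, Group (G w)] :
    Group (GraphProduct Γ G) :=
  inferInstanceAs (Group (Monoid.CoprodI G ⧸ Subgroup.normalClosure (graphProdRels Γ G)))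

/-- The canonical map from a vertex group into the graph product. -/
def GraphProduct.of {V : Type*} (Γ : SimpleGraph V) (G : V → Type*) [∀ w, Group (G w)]
    (u : V) : G u →* GraphProduct Γ G :=
  (QuotientGroup.mk' (Subgroup.normalClosure (graphProdRels Γ G))).comp Monoid.CoprodI.of

/-- The vertex subgroup of the graph product at the vertex `u`. -/
def vertexSubgroup {V : Type*} (Γ : SimpleGraph V) (G : V → Type*) [∀ w, Group (G w)]
    (u : V) : Subgroup (GraphProduct Γ G) :=
  (GraphProduct.of Γ G u).range

/-- An automorphism of the graph product is conjugating if it sends each vertex subgroup to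
a conjugate of a vertex subgroup. -/
def IsConjugating {V : Type*} (Γ : SimpleGraph V) (G : V → Type*) [∀ w, Group (G w)]
    (φ : MulAut (GraphProduct Γ G)) : Prop :=
  ∀ u : V, ∃ (v : V) (g : GraphProduct Γ G),
    Subgroup.map φ.toMonoidHom (vertexSubgroup Γ G u) =
      Subgroup.map (MulAut.conj g).toMonoidHom (vertexSubgroup Γ G v)

/-- An automorphism of the graph product is in `PConjAut` if it sends each vertex subgroup to
a conjugate of itself. -/
def IsPConjugating {V : Type*} (Γ : SimpleGraph V) (G : V → Type*) [∀ w, Group (G w)]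
    (φ : MulAut (GraphProduct Γ G)) : Prop :=
  ∀ u : V, ∃ g : GraphProduct Γ G,
    Subgroup.map φ.toMonoidHom (vertexSubgroup Γ G u) =
      Subgroup.map (MulAut.conj g).toMonoidHom (vertexSubgroup Γ G u)

/-- A vertex is universal if it is adjacent to every other vertex. -/
def IsUniversal {V : Type*} (Γ : SimpleGraph V) (u : V) : Prop :=
  ∀ v : V, v ≠ u → Γ.Adj u v

/-- Some vertex is non-adjacent to at least two other vertices. -/
def HasVertexWithTwoNonNeighbors {V : Type*} (Γ : SimpleGraph V) : Prop :=
  ∃ u v w : V, v ≠ w ∧ v ≠ u ∧ w ≠ u ∧ ¬Γ.Adj u v ∧ ¬Γ.Adj u w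

/-- A group `G` is SQ-universal if every countable group embeds into a quotient of `G`. -/
def SQUniversal (G : Type*) [Group G] : Prop :=
  ∀ (Q : Type) [Group Q] [Countable Q],
    ∃ (N : Subgroup G) (hN : N.Normal),
      haveI := hN
      ∃ f : Q →* G ⧸ N, Function.Injective f

/-- A quasimorphism on a group. -/
def IsQuasimorphism {H : Type*} [Group H] (f : H → ℝ) : Prop :=
  ∃ C : ℝ, 0 ≤ C ∧ ∀ g h : H, |f (g * h) - f g - f h| ≤ C

/-- A homogeneous map on a group. -/
def IsHomogeneous {H : Type*} [Group H] (f : H → ℝ) : Prop :=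
  ∀ (g : H) (k : ℤ), f (g ^ k) = (k : ℝ) * f g

/-- The space of homogeneous quasimorphisms of `H` is infinite-dimensional, expressed as: it is
not contained in the span of any finite set of functions. -/
def HasManyQuasimorphisms (H : Type*) [Group H] : Prop :=
  ¬ ∃ s : Finset (H → ℝ), ∀ f : H → ℝ, IsQuasimorphism f → IsHomogeneous f →
      f ∈ Submodule.span ℝ (s : Set (H → ℝ))

/-- A group virtually has many quasimorphisms if some finite-index subgroup has an
infinite-dimensional space of homogeneous quasimorphisms. -/
def VirtuallyManyQuasimorphisms (G : Type*) [Group G] : Prop :=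
  ∃ H : Subgroup G, H.FiniteIndex ∧ HasManyQuasimorphisms H

/-- A group is boundedly generated if it is the product of finitely many cyclic subgroups. -/
def BoundedlyGenerated (G : Type*) [Group G] : Prop :=
  ∃ l : List G, ∀ g : G, ∃ m : List ℤ, m.length = l.length ∧
    g = (List.zipWith (fun x (k : ℤ) => x ^ k) l m).prod

/-- A group is large if a finite-index subgroup surjects onto a nonabelian free group. -/
def IsLarge (G : Type*) [Group G] : Prop :=
  ∃ H : Subgroup G, H.FiniteIndex ∧ ∃ f : H →* FreeGroup (Fin 2), Function.Surjective f

/-- A group is virtually free abelian if it has a finite-index subgroup isomorphic to `ℤⁿ`. -/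
def VirtuallyFreeAbelian (G : Type*) [Group G] : Prop :=
  ∃ H : Subgroup G, H.FiniteIndex ∧ ∃ n : ℕ, Nonempty (H ≃* Multiplicative (Fin n → ℤ))

/-- The relators of a right-angled Coxeter group. -/
def racgRels {V : Type*} (Γ : SimpleGraph V) : Set (FreeGroup V) :=
  {w | (∃ v : V, w = FreeGroup.of v * FreeGroup.of v) ∨
    ∃ u v : V, Γ.Adj u v ∧ w = (FreeGroup.of u * FreeGroup.of v) ^ 2}

/-- The right-angled Coxeter group of a simplicial graph. -/
def RACG {V : Type*} (Γ : SimpleGraph V) := PresentedGroup (racgRels Γ)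

instance {V : Type*} (Γ : SimpleGraph V) : Group (RACG Γ) :=
  inferInstanceAs (Group (PresentedGroup (racgRels Γ)))

namespace GraphProduct

section Basic

variable {V : Type*} {Γ : SimpleGraph V} {G : V → Type*} [∀ w, Group (G w)]

theorem induction_on {motive : GraphProduct Γ G → Prop} (x : GraphProduct Γ G)
    (one : motive 1) (of : ∀ u (g : G u), motive (of Γ G u g))
    (mul : ∀ x y, motive x → motive y → motive (x * y)) : motive x := by
  obtain ⟨y, rfl⟩ := QuotientGroup.mk'_surjective (Subgroup.normalClosure (graphProdRels Γ G)) x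
  induction y using Monoid.CoprodI.induction_on with
  | one => exact one
  | of u g => exact of u g
  | mul x y hx hy => exact mul _ _ hx hy

theorem commute_of {u v : V} (h : Γ.Adj u v) (a : G u) (b : G v) :
    Commute (of Γ G u a) (of Γ G v b) := by
  have hrel : QuotientGroup.mk' (Subgroup.normalClosure (graphProdRels Γ G))
      (Monoid.CoprodI.of a * Monoid.CoprodI.of b *
        (Monoid.CoprodI.of a)⁻¹ * (Monoid.CoprodI.of b)⁻¹) = 1 :=
    (QuotientGroup.eq_one_iff _).2 (Subgroup.subset_normalClosure ⟨u, v, h, a, b, rfl⟩)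
  simp only [map_mul, map_inv] at hrel
  exact commutatorElement_eq_one_iff_commute.1 hrel

/-- The homomorphism out of a graph product induced by homomorphisms out of the vertex groups
whose images commute along edges. -/
def lift {H : Type*} [Group H] (f : ∀ u, G u →* H)
    (hf : ∀ u v, Γ.Adj u v → ∀ a b, Commute (f u a) (f v b)) : GraphProduct Γ G →* H :=
  QuotientGroup.lift _ (Monoid.CoprodI.lift f) <| Subgroup.normalClosure_le_normal <| by
    rintro _ ⟨u, v, huv, a, b, rfl⟩
    change Monoid.CoprodI.lift f _ = 1
    simp only [map_mul, map_inv, Monoid.CoprodI.lift_of]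
    exact commutatorElement_eq_one_iff_commute.2 (hf u v huv a b)

theorem lift_of {H : Type*} [Group H] (f : ∀ u, G u →* H)
    (hf : ∀ u v, Γ.Adj u v → ∀ a b, Commute (f u a) (f v b)) (u : V) (a : G u) :
    lift f hf (of Γ G u a) = f u a :=
  Monoid.CoprodI.lift_of f a

end Basic

end GraphProduct

section FreeProduct

variable {ι : Type*} {M : ι → Type*} [∀ i, Monoid (M i)] {i j : ι}

/-- The reduced word `a b₁ a b₂ ⋯ a bₙ` of a free product. -/
def alternatingWord (hij : i ≠ j) {a : M i} (ha : a ≠ 1) (l : List (M j))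
    (hl : ∀ b ∈ l, b ≠ 1) : Monoid.CoprodI.Word M where
  toList := l.flatMap fun b => [⟨i, a⟩, ⟨j, b⟩]
  ne_one := by
    intro x hx
    simp only [List.mem_flatMap, List.mem_cons, List.not_mem_nil, or_false] at hx
    obtain ⟨b, hb, rfl | rfl⟩ := hx
    · exact ha
    · exact hl b hb
  chain_ne := by
    clear hl
    induction l with
    | nil => simp
    | cons b l ih =>
      cases l with
      | nil => simpa using hij
      | cons c l => simpa [hij, hij.symm] using ih

theorem prod_alternatingWord (hij : i ≠ j) {a : M i} (ha : a ≠ 1) (l : List (M j))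
    (hl : ∀ b ∈ l, b ≠ 1) :
    (alternatingWord hij ha l hl).prod =
      (l.map fun b => Monoid.CoprodI.of a * Monoid.CoprodI.of b).prod := by
  rw [Monoid.CoprodI.Word.prod]
  simp only [alternatingWord]
  clear hl
  induction l with
  | nil => simp
  | cons b l ih => simp [ih, mul_assoc]

theorem not_commute_pow_of_mul_of (hij : i ≠ j) {a : M i} {b c : M j} (ha : a ≠ 1)
    (hb : b ≠ 1) (hc : c ≠ 1) (hbc : b ≠ c) {k : ℕ} (hk : k ≠ 0) :
    ¬Commute ((Monoid.CoprodI.of a * Monoid.CoprodI.of b : Monoid.CoprodI M) ^ k)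
      ((Monoid.CoprodI.of a * Monoid.CoprodI.of c) ^ k) := by
  classical
  intro h
  have hbc1 : ∀ x ∈ List.replicate k b ++ List.replicate k c, x ≠ 1 := by
    simp [List.mem_replicate]; grind
  have hcb1 : ∀ x ∈ List.replicate k c ++ List.replicate k b, x ≠ 1 := by
    simp [List.mem_replicate]; grind
  have heq : alternatingWord hij ha _ hbc1 = alternatingWord hij ha _ hcb1 := by
    apply Monoid.CoprodI.Word.equiv.symm.injective
    change (alternatingWord hij ha _ hbc1).prod = (alternatingWord hij ha _ hcb1).prod
    rw [prod_alternatingWord, prod_alternatingWord]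
    simpa using h.eq
  obtain ⟨k, rfl⟩ := Nat.exists_eq_succ_of_ne_zero hk
  have hlist := congrArg Monoid.CoprodI.Word.toList heq
  simp [alternatingWord, List.replicate_succ] at hlist
  exact hbc hlist.1

end FreeProduct

theorem VirtuallyFreeAbelian.exists_commute_pow {G : Type*} [Group G]
    (h : VirtuallyFreeAbelian G) : ∃ k : ℕ, k ≠ 0 ∧ ∀ x y : G, Commute (x ^ k) (y ^ k) := by
  obtain ⟨H, hH, n, ⟨e⟩⟩ := h
  refine ⟨H.normalCore.index, Subgroup.FiniteIndex.index_ne_zero, fun x y => ?_⟩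
  have hx := H.normalCore_le (H.normalCore.pow_index_mem x)
  have hy := H.normalCore_le (H.normalCore.pow_index_mem y)
  have hxy : (⟨_, hx⟩ * ⟨_, hy⟩ : H) = ⟨_, hy⟩ * ⟨_, hx⟩ :=
    e.injective (by rw [map_mul, map_mul, mul_comm])
  exact congrArg Subtype.val hxy

open scoped IsMulCommutative in
theorem virtuallyFreeAbelian_of_isMulCommutative {G : Type*} [Group G] (N : Subgroup G)
    [N.FiniteIndex] [IsMulCommutative N] (hfg : N.FG) : VirtuallyFreeAbelian G := by
  have : Group.FG N := (Group.fg_iff_subgroup_fg N).2 hfg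
  obtain ⟨ι, j, _, _, p, hp, e, ⟨φ⟩⟩ := CommGroup.equiv_free_prod_prod_multiplicative_zmod N
  have (i : ι) : NeZero (p i ^ e i) := ⟨pow_ne_zero _ (hp i).ne_zero⟩
  have (i : ι) : Finite (Multiplicative (ZMod (p i ^ e i))) :=
    inferInstanceAs (Finite (ZMod (p i ^ e i)))
  let K : Subgroup N := ((MonoidHom.snd _ _).comp φ.toMonoidHom).ker
  have hK : K.FiniteIndex := Subgroup.finiteIndex_ker _
  let f : (j → Multiplicative ℤ) →* G :=
    N.subtype.comp (φ.symm.toMonoidHom.comp (MonoidHom.inl _ _))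
  have hf : Function.Injective f := by
    intro x y hxy
    have := φ.symm.injective (Subtype.ext hxy)
    exact congrArg Prod.fst this
  have hrange : f.range = K.map N.subtype := by
    ext x
    constructor
    · rintro ⟨y, rfl⟩
      refine ⟨φ.symm (y, 1), ?_, rfl⟩
      change (φ (φ.symm (y, 1))).2 = 1
      simp
    · rintro ⟨y, hy, rfl⟩
      refine ⟨(φ y).1, ?_⟩
      change ((φ.symm ((φ y).1, 1) : N) : G) = y
      have hy' : (φ y).2 = 1 := hy
      rw [← hy', Prod.mk.eta, φ.symm_apply_apply]
  refine ⟨f.range, ⟨?_⟩, Fintype.card j, ⟨(MonoidHom.ofInjective hf).symm.trans ?_⟩⟩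
  · rw [hrange, Subgroup.index_map_subtype]
    exact mul_ne_zero hK.index_ne_zero Subgroup.FiniteIndex.index_ne_zero
  · exact
      { toFun := fun x => Multiplicative.ofAdd fun i => (x ((Fintype.equivFin j).symm i)).toAdd
        invFun := fun x i => Multiplicative.ofAdd (x.toAdd (Fintype.equivFin j i))
        left_inv := fun x => by ext; simp
        right_inv := fun x => by
          apply Multiplicative.toAdd.injective
          funext i
          simp
        map_mul' := fun _ _ => rfl }

namespace GraphProduct

section NotVirtuallyAbelian

variable {V : Type*} {Γ : SimpleGraph V} {G : V → Type*} [∀ w, Group (G w)]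

/-- A colouring `c` of some of the vertices in which adjacent coloured vertices have the same
colour induces a homomorphism to a free product indexed by the colours. -/
theorem exists_hom_coprodI {κ : Type*} [DecidableEq V] (c : V → Option κ)
    (hc : ∀ u v, Γ.Adj u v → ∀ s ∈ c u, ∀ t ∈ c v, s = t) :
    ∃ f : GraphProduct Γ G →* Monoid.CoprodI fun _ : κ => ∀ w, G w,
      ∀ u, ∀ s ∈ c u, ∀ a, f (of Γ G u a) =
        Monoid.CoprodI.of (M := fun _ : κ => ∀ w, G w) (i := s) (Pi.mulSingle u a) := by
  let F (u : V) : G u →* Monoid.CoprodI fun _ : κ => ∀ w, G w :=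
    (c u).elim 1 fun s =>
      (Monoid.CoprodI.of (M := fun _ : κ => ∀ w, G w) (i := s)).comp (MonoidHom.mulSingle G u)
  have hF : ∀ u, ∀ s ∈ c u, ∀ a, F u a =
      Monoid.CoprodI.of (M := fun _ : κ => ∀ w, G w) (i := s) (Pi.mulSingle u a) := by
    intro u s hs a
    rw [Option.mem_def] at hs
    simp [F, hs]
  have hcomm : ∀ u v, Γ.Adj u v → ∀ a b, Commute (F u a) (F v b) := by
    intro u v huv a b
    rcases hu : c u with _ | s
    · simp [F, hu]
    rcases hv : c v with _ | t
    · simp [F, hv]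
    obtain rfl := hc u v huv s hu t hv
    rw [hF u s hu, hF v s hv]
    exact (Pi.mulSingle_commute huv.ne a b).map
      (Monoid.CoprodI.of (M := fun _ : κ => ∀ w, G w) (i := s))
  refine ⟨lift F hcomm, fun u s hs a => ?_⟩
  rw [lift_of, hF u s hs]

theorem card_eq_two_of_virtuallyFreeAbelian [∀ w, Nontrivial (G w)]
    (h : VirtuallyFreeAbelian (GraphProduct Γ G)) {u : V} (hu : ¬IsUniversal Γ u) :
    Nat.card (G u) = 2 := by
  classical
  obtain ⟨k, hk, hcomm⟩ := h.exists_commute_pow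
  simp only [IsUniversal, not_forall] at hu
  obtain ⟨v, hvu, huv⟩ := hu
  obtain ⟨a, ha⟩ := exists_ne (1 : G v)
  obtain ⟨b, hb⟩ := exists_ne (1 : G u)
  rw [Nat.card_eq_two_iff' (1 : G u)]
  refine ⟨b, hb, fun d hd => ?_⟩
  by_contra hdb
  have hvu' : ¬Γ.Adj v u := fun h => huv h.symm
  obtain ⟨f, hf⟩ := exists_hom_coprodI (Γ := Γ) (G := G)
    (fun w => if w = v then some true else if w = u then some false else none) (by grind)
  have hfv := hf v true (by simp) a
  have hfu := hf u false (by simp [hvu.symm])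
  refine not_commute_pow_of_mul_of (M := fun _ : Bool => ∀ w, G w) (i := true) (j := false)
    (by simp) (a := Pi.mulSingle v a) (b := Pi.mulSingle u b) (c := Pi.mulSingle u d)
    (by simpa) (by simpa) (by simpa) (by simpa [Pi.mulSingle_inj] using Ne.symm hdb) hk ?_
  have := (hcomm (of Γ G v a * of Γ G u b) (of Γ G v a * of Γ G u d)).map f
  simpa only [map_pow, map_mul, hfv, hfu] using this

theorem eq_of_not_adj_of_virtuallyFreeAbelian [∀ w, Nontrivial (G w)]
    (h : VirtuallyFreeAbelian (GraphProduct Γ G)) {u v w : V} (hv : v ≠ u) (hw : w ≠ u)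
    (huv : ¬Γ.Adj u v) (huw : ¬Γ.Adj u w) : v = w := by
  classical
  obtain ⟨k, hk, hcomm⟩ := h.exists_commute_pow
  obtain ⟨a, ha⟩ := exists_ne (1 : G u)
  obtain ⟨b, hb⟩ := exists_ne (1 : G v)
  obtain ⟨d, hd⟩ := exists_ne (1 : G w)
  by_contra hvw
  have hvu : ¬Γ.Adj v u := fun h => huv h.symm
  have hwu : ¬Γ.Adj w u := fun h => huw h.symm
  obtain ⟨f, hf⟩ := exists_hom_coprodI (Γ := Γ) (G := G)
    (fun x => if x = u then some true else if x = v ∨ x = w then some false else none)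
    (by grind)
  have hfu := hf u true (by simp) a
  have hfv := hf v false (by simp [hv]) b
  have hfw := hf w false (by simp [hw]) d
  have hbd : (Pi.mulSingle v b : ∀ w, G w) ≠ Pi.mulSingle w d := fun h =>
    hb (by simpa [Pi.mulSingle_eq_of_ne hvw] using congrFun h v)
  refine not_commute_pow_of_mul_of (M := fun _ : Bool => ∀ w, G w) (i := true) (j := false)
    (by simp) (a := Pi.mulSingle u a) (b := Pi.mulSingle v b) (c := Pi.mulSingle w d)
    (by simpa) (by simpa) (by simpa) hbd hk ?_
  have := (hcomm (of Γ G u a * of Γ G v b) (of Γ G u a * of Γ G w d)).map f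
  simpa only [map_pow, map_mul, hfu, hfv, hfw] using this

end NotVirtuallyAbelian

section VirtuallyAbelian

variable {V : Type*} (Γ : SimpleGraph V) (G : V → Type*) [∀ w, Group (G w)]

/-- The products of two nontrivial elements of non-adjacent vertex groups. -/
def nonadjProducts : Set (GraphProduct Γ G) :=
  {x | ∃ (u v : V) (a : G u) (b : G v), u ≠ v ∧ ¬Γ.Adj u v ∧ a ≠ 1 ∧ b ≠ 1 ∧
    x = of Γ G u a * of Γ G v b}

theorem finite_nonadjProducts [Finite V] [∀ w, Finite (G w)] :
    (nonadjProducts Γ G).Finite := by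
  refine (Set.finite_range fun p : (Σ u, G u) × (Σ u, G u) =>
    of Γ G p.1.1 p.1.2 * of Γ G p.2.1 p.2.2).subset ?_
  rintro _ ⟨u, v, a, b, -, -, -, -, rfl⟩
  exact ⟨(⟨u, a⟩, ⟨v, b⟩), rfl⟩

variable {Γ G}

theorem eq_and_mul_self_of_card_eq_two {H : Type*} [Group H] (h : Nat.card H = 2) {a b : H}
    (ha : a ≠ 1) (hb : b ≠ 1) : b = a ∧ a * a = 1 := by
  obtain ⟨c, -, hc⟩ := (Nat.card_eq_two_iff' (1 : H)).1 h
  refine ⟨(hc b hb).trans (hc a ha).symm, ?_⟩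
  by_contra h
  exact ha (mul_eq_left.1 ((hc _ h).trans (hc a ha).symm))

theorem eq_and_mul_self_of_not_adj
    (hcard : ∀ u : V, ¬IsUniversal Γ u → Nat.card (G u) = 2)
    {u v : V} (huv : u ≠ v) (h : ¬Γ.Adj u v) {a b : G u}
    (ha : a ≠ 1) (hb : b ≠ 1) : b = a ∧ of Γ G u a * of Γ G u a = 1 := by
  have := eq_and_mul_self_of_card_eq_two (hcard u fun hu => h (hu v huv.symm)) ha hb
  exact ⟨this.1, by rw [← map_mul, this.2, map_one]⟩

theorem commute_of_mem_nonadjProducts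
    (hcard : ∀ u : V, ¬IsUniversal Γ u → Nat.card (G u) = 2)
    (hadj : ∀ u v w : V, v ≠ u → w ≠ u → ¬Γ.Adj u v → ¬Γ.Adj u w → v = w)
    {x y : GraphProduct Γ G} (hx : x ∈ nonadjProducts Γ G)
    (hy : y ∈ nonadjProducts Γ G) : Commute x y := by
  obtain ⟨u, v, a, b, huv, h, ha, hb, rfl⟩ := hx
  obtain ⟨u', v', a', b', huv', h', ha', hb', rfl⟩ := hy
  have hs : ¬Γ.Adj v u := fun t => h t.symm
  have hs' : ¬Γ.Adj v' u' := fun t => h' t.symm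
  by_cases h1 : u' = u
  · subst h1
    obtain rfl := hadj u' v v' huv.symm huv'.symm h h'
    rw [(eq_and_mul_self_of_not_adj hcard huv h ha ha').1,
      (eq_and_mul_self_of_not_adj hcard huv.symm hs hb hb').1]
  by_cases h2 : u' = v
  · subst h2
    obtain rfl := hadj u' u v' huv huv'.symm hs h'
    obtain ⟨rfl, ha2⟩ := eq_and_mul_self_of_not_adj hcard huv h ha hb'
    obtain ⟨rfl, hb2⟩ := eq_and_mul_self_of_not_adj hcard huv.symm hs hb ha'
    rw [Commute, SemiconjBy, mul_assoc, ← mul_assoc (of Γ G u' a'), hb2, one_mul, ha2,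
      mul_assoc, ← mul_assoc (of Γ G u b'), ha2, one_mul, hb2]
  have h3 : v' ≠ u := by
    rintro rfl
    exact h2 (hadj v' u' v huv' huv.symm hs' h)
  have h4 : v' ≠ v := by
    rintro rfl
    exact h1 (hadj v' u' u huv' huv hs' hs)
  have e1 : Γ.Adj u u' := by
    by_contra t
    exact h2 (hadj u u' v h1 huv.symm t h)
  have e2 : Γ.Adj u v' := by
    by_contra t
    exact h4 (hadj u v' v h3 huv.symm t h)
  have e3 : Γ.Adj v u' := by
    by_contra t
    exact h1 (hadj v u' u h2 huv t hs)
  have e4 : Γ.Adj v v' := by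
    by_contra t
    exact h3 (hadj v v' u h4 huv t hs)
  exact ((commute_of e1 _ _).mul_right (commute_of e2 _ _)).mul_left
    ((commute_of e3 _ _).mul_right (commute_of e4 _ _))

theorem conj_mem_nonadjProducts
    (hcard : ∀ u : V, ¬IsUniversal Γ u → Nat.card (G u) = 2)
    (hadj : ∀ u v w : V, v ≠ u → w ≠ u → ¬Γ.Adj u v → ¬Γ.Adj u w → v = w)
    {x : GraphProduct Γ G} (hx : x ∈ nonadjProducts Γ G) (w : V)
    (g : G w) : of Γ G w g * x * (of Γ G w g)⁻¹ ∈ nonadjProducts Γ G := by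
  by_cases hg : g = 1
  · simpa [hg] using hx
  obtain ⟨u, v, a, b, huv, h, ha, hb, rfl⟩ := hx
  have hs : ¬Γ.Adj v u := fun t => h t.symm
  by_cases h1 : w = u
  · subst h1
    obtain ⟨rfl, hg2⟩ := eq_and_mul_self_of_not_adj hcard huv h ha hg
    refine ⟨v, w, b, g, huv.symm, hs, hb, ha, ?_⟩
    rw [← mul_assoc, hg2, one_mul, inv_eq_of_mul_eq_one_left hg2]
  by_cases h2 : w = v
  · subst h2
    obtain ⟨rfl, hg2⟩ := eq_and_mul_self_of_not_adj hcard huv.symm hs hb hg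
    refine ⟨w, u, g, a, huv.symm, hs, hg, ha, ?_⟩
    rw [mul_assoc, mul_inv_cancel_right]
  have e1 : Γ.Adj w u := by
    by_contra t
    exact h2 (hadj u w v h1 huv.symm (fun s => t s.symm) h)
  have e2 : Γ.Adj w v := by
    by_contra t
    exact h1 (hadj v w u h2 huv (fun s => t s.symm) hs)
  refine ⟨u, v, a, b, huv, h, ha, hb, ?_⟩
  rw [((commute_of e1 _ _).mul_right (commute_of e2 _ _)).eq, mul_inv_cancel_right]

theorem normal_closure_nonadjProducts
    (hcard : ∀ u : V, ¬IsUniversal Γ u → Nat.card (G u) = 2)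
    (hadj : ∀ u v w : V, v ≠ u → w ≠ u → ¬Γ.Adj u v → ¬Γ.Adj u w → v = w) :
    (Subgroup.closure (nonadjProducts Γ G)).Normal where
  conj_mem n hn x := by
    induction x using GraphProduct.induction_on generalizing n with
    | one => simpa using hn
    | of u g =>
      induction hn using Subgroup.closure_induction with
      | mem x hx => exact Subgroup.subset_closure (conj_mem_nonadjProducts hcard hadj hx u g)
      | one => simp
      | mul x y _ _ hx hy => rw [← conj_mul]; exact mul_mem hx hy
      | inv x _ hx => rw [← conj_inv]; exact inv_mem hx
    | mul x y hx hy =>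
      simpa only [mul_inv_rev, mul_assoc] using hx _ (hy _ hn)

theorem finiteIndex_closure_nonadjProducts
    (hcard : ∀ u : V, ¬IsUniversal Γ u → Nat.card (G u) = 2)
    (hadj : ∀ u v w : V, v ≠ u → w ≠ u → ¬Γ.Adj u v → ¬Γ.Adj u w → v = w)
    [Finite V] [∀ w, Finite (G w)] :
    (Subgroup.closure (nonadjProducts Γ G)).FiniteIndex := by
  classical
  have := Fintype.ofFinite V
  have := normal_closure_nonadjProducts hcard hadj
  set N := Subgroup.closure (nonadjProducts Γ G)
  let F (u : V) : G u →* GraphProduct Γ G ⧸ N := (QuotientGroup.mk' N).comp (of Γ G u)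
  have hF : Pairwise fun u v => ∀ a b, Commute (F u a) (F v b) := by
    intro u v huv a b
    by_cases h : Γ.Adj u v
    · exact (commute_of h a b).map (QuotientGroup.mk' N)
    by_cases ha : a = 1
    · simp [ha]
    by_cases hb : b = 1
    · simp [hb]
    have hab : F u a * F v b = 1 :=
      (QuotientGroup.eq_one_iff _).2
        (Subgroup.subset_closure ⟨u, v, a, b, huv, h, ha, hb, rfl⟩)
    rw [eq_inv_of_mul_eq_one_left hab]
    exact (Commute.refl _).inv_left
  have hsurj : Function.Surjective (MonoidHom.noncommPiCoprod F hF) := by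
    intro y
    obtain ⟨x, rfl⟩ := QuotientGroup.mk'_surjective N y
    induction x using GraphProduct.induction_on with
    | one => exact ⟨1, by simp⟩
    | of u g => exact ⟨Pi.mulSingle u g, MonoidHom.noncommPiCoprod_mulSingle F u g⟩
    | mul x y hx hy =>
      obtain ⟨x', hx⟩ := hx
      obtain ⟨y', hy⟩ := hy
      exact ⟨x' * y', by rw [map_mul, hx, hy, map_mul]⟩
  have : Finite (GraphProduct Γ G ⧸ N) := Finite.of_surjective _ hsurj
  exact N.finiteIndex_of_finite_quotient

theorem virtuallyFreeAbelian
    (hcard : ∀ u : V, ¬IsUniversal Γ u → Nat.card (G u) = 2)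
    (hadj : ∀ u v w : V, v ≠ u → w ≠ u → ¬Γ.Adj u v → ¬Γ.Adj u w → v = w)
    [Finite V] [∀ w, Finite (G w)] :
    VirtuallyFreeAbelian (GraphProduct Γ G) := by
  have := finiteIndex_closure_nonadjProducts hcard hadj
  have : IsMulCommutative (Subgroup.closure (nonadjProducts Γ G)) :=
    Subgroup.isMulCommutative_closure fun _ hx _ hy =>
      commute_of_mem_nonadjProducts hcard hadj hx hy
  exact virtuallyFreeAbelian_of_isMulCommutative (Subgroup.closure (nonadjProducts Γ G))
    ((Subgroup.fg_iff _).2 ⟨_, rfl, finite_nonadjProducts Γ G⟩)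

end VirtuallyAbelian

end GraphProduct

/-- A graph product of nontrivial finite groups is virtually free abelian iff every
non-universal vertex group has order 2 and every vertex is non-adjacent to at most one other
vertex. -/
theorem graphProduct_virtuallyFreeAbelian_iff {V : Type} [Fintype V] (Γ : SimpleGraph V)
    (G : V → Type) [∀ w, Group (G w)] [∀ w, Finite (G w)] [∀ w, Nontrivial (G w)] :
    VirtuallyFreeAbelian (GraphProduct Γ G) ↔
      ((∀ u : V, ¬IsUniversal Γ u → Nat.card (G u) = 2) ∧
        (∀ u v w : V, v ≠ u → w ≠ u → ¬Γ.Adj u v → ¬Γ.Adj u w → v = w)) := by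
  refine ⟨fun h => ⟨fun u hu => GraphProduct.card_eq_two_of_virtuallyFreeAbelian h hu,
    fun u v w hv hw huv huw =>
      GraphProduct.eq_of_not_adj_of_virtuallyFreeAbelian h hv hw huv huw⟩, ?_⟩
  rintro ⟨hcard, hadj⟩
  exact GraphProduct.virtuallyFreeAbelian hcard hadj
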